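/- Let f : ℝⁿ → ℝ be C³ such that ‖∇f‖ is a constant c with c < 1, and define χᵢⱼ = ‖∇f‖² ∂ᵢ∂ⱼf + Δf (δᵢⱼ − ∂ᵢf ∂ⱼf). Then Σᵢⱼ (∂ᵢ χᵢⱼ)(x) ∂ⱼf(x) = 0 for all x ∈ ℝⁿ if and only if Hess f(x) = 0 for all x ∈ ℝⁿ (i.e. f is an affine function). -/

import Mathlib

/-- The `i`-th partial derivative `∂ᵢ f` of a function `f : ℝⁿ → ℝ`. -/
noncomputable def pd {n : ℕ} (f : (Fin n → ℝ) → ℝ) (i : Fin n) (x : Fin n → ℝ) : ℝ :=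
  fderiv ℝ f x (Pi.single i 1)

/-- The second partial derivative `∂ᵢ ∂ⱼ f` (entry of the Hessian matrix). -/
noncomputable def pd2 {n : ℕ} (f : (Fin n → ℝ) → ℝ) (i j : Fin n) (x : Fin n → ℝ) : ℝ :=
  pd (pd f j) i x

/-- The squared gradient norm `‖∇f‖² = ∑ i, (∂ᵢ f)²`. -/
noncomputable def gradNormSq {n : ℕ} (f : (Fin n → ℝ) → ℝ) (x : Fin n → ℝ) : ℝ :=
  ∑ i, pd f i x ^ 2

/-- The Euclidean Laplacian `Δf = ∑ i, ∂ᵢ ∂ᵢ f`. -/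
noncomputable def lap {n : ℕ} (f : (Fin n → ℝ) → ℝ) (x : Fin n → ℝ) : ℝ :=
  ∑ i, pd2 f i i x

/-- The deformed metric `g̃ᵢⱼ = δᵢⱼ - ∂ᵢf ∂ⱼf` as a matrix. -/
noncomputable def gTilde {n : ℕ} (f : (Fin n → ℝ) → ℝ) (x : Fin n → ℝ) :
    Matrix (Fin n) (Fin n) ℝ :=
  1 - Matrix.vecMulVec (fun i => pd f i x) (fun i => pd f i x)

/-- The Christoffel symbols `Γ̃ᵏᵢⱼ` of the metric `g̃` in Cartesian coordinates. -/
noncomputable def christoffel {n : ℕ} (f : (Fin n → ℝ) → ℝ) (k i j : Fin n)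
    (x : Fin n → ℝ) : ℝ :=
  (1 / 2) * ∑ l, (gTilde f x)⁻¹ k l *
    (pd (fun y => gTilde f y j l) i x + pd (fun y => gTilde f y i l) j x
      - pd (fun y => gTilde f y i j) l x)

/-- The paper's symmetric tensor field
`χᵢⱼ = ‖∇f‖² ∂ᵢ∂ⱼf + Δf (δᵢⱼ - ∂ᵢf ∂ⱼf)` in Cartesian coordinates. -/
noncomputable def chi {n : ℕ} (f : (Fin n → ℝ) → ℝ) (i j : Fin n) (x : Fin n → ℝ) : ℝ :=
  gradNormSq f x * pd2 f i j x
    + lap f x * ((if i = j then (1 : ℝ) else 0) - pd f i x * pd f j x)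

/-- The divergence of the tensor field `χ` evaluated on a vector `V`:
`(div χ)(V) = ∑ i j, (∂ᵢ χᵢⱼ) Vⱼ`. -/
noncomputable def divChi {n : ℕ} (f : (Fin n → ℝ) → ℝ) (V : Fin n → ℝ)
    (x : Fin n → ℝ) : ℝ :=
  ∑ i, ∑ j, pd (fun y => chi f i j y) i x * V j

section PartialDerivatives

variable {n : ℕ} {f g : (Fin n → ℝ) → ℝ} {x : Fin n → ℝ}

theorem pd_add (hf : DifferentiableAt ℝ f x) (hg : DifferentiableAt ℝ g x) (i : Fin n) :
    pd (fun y => f y + g y) i x = pd f i x + pd g i x := by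
  simp [pd, fderiv_fun_add hf hg]

theorem pd_mul (hf : DifferentiableAt ℝ f x) (hg : DifferentiableAt ℝ g x) (i : Fin n) :
    pd (fun y => f y * g y) i x = pd f i x * g x + f x * pd g i x := by
  simp [pd, fderiv_fun_mul hf hg]
  ring

theorem pd_const_sub (a : ℝ) (i : Fin n) : pd (fun y => a - f y) i x = -pd f i x := by
  simp [pd, fderiv_const_sub]

theorem pd_const (a : ℝ) (i : Fin n) : pd (fun _ => a) i x = 0 := by
  simp [pd]

theorem pd_sum {ι : Type*} {s : Finset ι} {F : ι → (Fin n → ℝ) → ℝ}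
    (hF : ∀ k ∈ s, DifferentiableAt ℝ (F k) x) (i : Fin n) :
    pd (fun y => ∑ k ∈ s, F k y) i x = ∑ k ∈ s, pd (F k) i x := by
  simp [pd, fderiv_fun_sum hF]

theorem ContDiff.pd {m k : WithTop ℕ∞} (hf : ContDiff ℝ k f) (hmk : m + 1 ≤ k) (i : Fin n) :
    ContDiff ℝ m (pd f i) :=
  (hf.fderiv_right hmk).clm_apply contDiff_const

theorem pd2_comm (hf : ContDiff ℝ 2 f) (i j : Fin n) : pd2 f i j = pd2 f j i := by
  ext x
  have hd : DifferentiableAt ℝ (fderiv ℝ f) x :=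
    ((hf.fderiv_right (m := 1) (by norm_num)).differentiable (by norm_num)) x
  have key : ∀ v w, fderiv ℝ (fun y => fderiv ℝ f y w) x v = fderiv ℝ (fderiv ℝ f) x v w := by
    intro v w
    rw [fderiv_clm_apply hd (differentiableAt_const w)]
    simp
  have hs : IsSymmSndFDerivAt ℝ f x :=
    hf.contDiffAt.isSymmSndFDerivAt (by simp)
  change fderiv ℝ (fun y => fderiv ℝ f y _) x _ = fderiv ℝ (fun y => fderiv ℝ f y _) x _
  rw [key, key]
  exact hs _ _

end PartialDerivatives

section ConstantGradientNorm

variable {n : ℕ} {f : (Fin n → ℝ) → ℝ} {a : ℝ}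

/-- If `‖∇f‖` is constant, then `Hess f` annihilates `∇f`. -/
theorem sum_pd_mul_pd2_eq_zero (hf : ContDiff ℝ 2 f) (ha : ∀ x, gradNormSq f x = a)
    (j : Fin n) (x : Fin n → ℝ) : ∑ i, pd f i x * pd2 f j i x = 0 := by
  have hd : ∀ i, DifferentiableAt ℝ (pd f i) x := fun i =>
    (hf.pd (m := 1) (by norm_num) i).differentiable (by norm_num) x
  have h : pd (fun y => ∑ i, pd f i y * pd f i y) j x = 0 := by
    have : (fun y => ∑ i, pd f i y * pd f i y) = fun _ => a := by
      ext y
      simp [← ha y, gradNormSq, sq]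
    rw [this, pd_const]
  rw [pd_sum (fun i _ => (hd i).fun_mul (hd i))] at h
  simp only [pd_mul (hd _) (hd _)] at h
  have h2 : 2 * ∑ i, pd f i x * pd2 f j i x = 0 := by
    rw [← h, Finset.mul_sum]
    exact Finset.sum_congr rfl fun i _ => by simp only [pd2]; ring
  linarith

/-- Bochner's formula for a function on `ℝⁿ` with constant `‖∇f‖`. -/
theorem sum_pd_lap_mul_pd (hf : ContDiff ℝ 3 f) (ha : ∀ x, gradNormSq f x = a)
    (x : Fin n → ℝ) :
    ∑ i, pd (lap f) i x * pd f i x = -∑ i, ∑ j, pd2 f i j x ^ 2 := by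
  have hf2 : ContDiff ℝ 2 f := hf.of_le (by norm_num)
  have hu : ∀ i, ContDiff ℝ 2 (pd f i) := fun i => hf.pd (by norm_num) i
  have hd : ∀ i, DifferentiableAt ℝ (pd f i) x := fun i =>
    (hu i).differentiable (by norm_num) x
  have hd2 : ∀ i j, DifferentiableAt ℝ (pd2 f i j) x := fun i j =>
    ((hu j).pd (m := 1) (by norm_num) i).differentiable (by norm_num) x
  have hlap : ∀ i, pd (lap f) i x = ∑ j, pd (pd2 f j i) j x := by
    intro i
    change pd (fun y => ∑ j, pd2 f j j y) i x = _
    rw [pd_sum fun j _ => hd2 j j]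
    refine Finset.sum_congr rfl fun j _ => ?_
    rw [pd2_comm hf2 j i]
    exact congrFun (pd2_comm (hu j) i j) x
  have h : ∀ j, ∑ i, (pd2 f j i x ^ 2 + pd (pd2 f j i) j x * pd f i x) = 0 := by
    intro j
    have h0 : pd (fun y => ∑ i, pd f i y * pd2 f j i y) j x = 0 := by
      simp only [sum_pd_mul_pd2_eq_zero hf2 ha, pd_const]
    rw [pd_sum (fun i _ => (hd i).fun_mul (hd2 j i))] at h0
    rw [← h0]
    refine Finset.sum_congr rfl fun i _ => ?_
    rw [pd_mul (hd i) (hd2 j i)]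
    simp only [pd2]
    ring
  have hsum := Finset.sum_eq_zero fun j (_ : j ∈ Finset.univ) => h j
  simp only [Finset.sum_add_distrib] at hsum
  simp only [hlap, Finset.sum_mul]
  rw [Finset.sum_comm]
  linarith

theorem divChi_grad (hf : ContDiff ℝ 3 f) (ha : ∀ x, gradNormSq f x = a) (x : Fin n → ℝ) :
    divChi f (fun j => pd f j x) x = -(∑ i, ∑ j, pd2 f i j x ^ 2) - a * lap f x ^ 2 := by
  have hf2 : ContDiff ℝ 2 f := hf.of_le (by norm_num)
  have hu : ∀ i, ContDiff ℝ 2 (pd f i) := fun i => hf.pd (by norm_num) i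
  have hd : ∀ i, DifferentiableAt ℝ (pd f i) x := fun i =>
    (hu i).differentiable (by norm_num) x
  have hd2 : ∀ i j, DifferentiableAt ℝ (pd2 f i j) x := fun i j =>
    ((hu j).pd (m := 1) (by norm_num) i).differentiable (by norm_num) x
  have hdlap : DifferentiableAt ℝ (lap f) x :=
    DifferentiableAt.fun_sum fun i _ => hd2 i i
  have hlap : ∀ j, ∑ i, pd (pd2 f i j) i x = pd (lap f) j x := by
    intro j
    change _ = pd (fun y => ∑ i, pd2 f i i y) j x
    rw [pd_sum fun i _ => hd2 i i]
    refine Finset.sum_congr rfl fun i _ => ?_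
    rw [pd2_comm hf2 i j]
    exact congrFun (pd2_comm (hu i) i j) x
  have hchi : ∀ i j, pd (fun y => chi f i j y) i x =
      a * pd (pd2 f i j) i x
        + (pd (lap f) i x * ((if i = j then (1 : ℝ) else 0) - pd f i x * pd f j x)
        - lap f x * (pd2 f i i x * pd f j x + pd f i x * pd2 f i j x)) := by
    intro i j
    have hg := (hd i).fun_mul (hd j)
    simp only [chi, ha]
    rw [pd_add ((differentiableAt_const a).fun_mul (hd2 i j))
        (hdlap.fun_mul (hg.const_sub _)),
      pd_mul (differentiableAt_const a) (hd2 i j), pd_mul hdlap (hg.const_sub _),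
      pd_const, pd_const_sub, pd_mul (hd i) (hd j)]
    simp only [pd2]
    ring
  have hrow : ∀ i, ∑ j, pd (fun y => chi f i j y) i x * pd f j x =
      a * ∑ j, pd (pd2 f i j) i x * pd f j x + pd (lap f) i x * pd f i x
        - a * (pd (lap f) i x * pd f i x) - a * lap f x * pd2 f i i x := by
    intro i
    have h1 : ∑ j, (if i = j then (1 : ℝ) else 0) * pd f j x = pd f i x := by simp
    have h2 := sum_pd_mul_pd2_eq_zero hf2 ha i x
    have h3 : ∑ j, pd f j x ^ 2 = a := ha x
    calc _ = a * ∑ j, pd (pd2 f i j) i x * pd f j x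
          + pd (lap f) i x * ∑ j, (if i = j then (1 : ℝ) else 0) * pd f j x
          - (pd (lap f) i x * pd f i x) * ∑ j, pd f j x ^ 2
          - (lap f x * pd2 f i i x) * ∑ j, pd f j x ^ 2
          - (lap f x * pd f i x) * ∑ j, pd f j x * pd2 f i j x := by
            simp only [Finset.mul_sum, ← Finset.sum_add_distrib, ← Finset.sum_sub_distrib]
            refine Finset.sum_congr rfl fun j _ => ?_
            rw [hchi]
            ring
      _ = _ := by
            rw [h1, h2, h3]
            ring
  have htrace : ∑ i, ∑ j, pd (pd2 f i j) i x * pd f j x = ∑ j, pd (lap f) j x * pd f j x := by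
    rw [Finset.sum_comm]
    exact Finset.sum_congr rfl fun j _ => by rw [← Finset.sum_mul, hlap]
  have hS : ∑ i, pd2 f i i x = lap f x := rfl
  simp only [divChi, hrow, Finset.sum_sub_distrib, Finset.sum_add_distrib, ← Finset.mul_sum]
  rw [htrace, hS, sum_pd_lap_mul_pd hf ha]
  ring

end ConstantGradientNorm

/-- Flat-space case of Corollary 3.2: if `f : ℝⁿ → ℝ` is `C³` with `‖∇f‖` equal to a
constant `c < 1`, then `(div χ)(∇f) = 0` everywhere if and only if `Hess f ≡ 0`,
i.e. `f` is an affine function. -/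
theorem stmt_13 {n : ℕ} (f : (Fin n → ℝ) → ℝ) (hf : ContDiff ℝ 3 f)
    (c : ℝ) (hc : c < 1) (hconst : ∀ x, Real.sqrt (gradNormSq f x) = c) :
    (∀ x, divChi f (fun j => pd f j x) x = 0) ↔ (∀ x, ∀ i j, pd2 f i j x = 0) := by
  have hn : ∀ x, 0 ≤ gradNormSq f x := fun x => Finset.sum_nonneg fun i _ => sq_nonneg _
  have ha : ∀ x, gradNormSq f x = c ^ 2 := fun x => by
    rw [← hconst x, Real.sq_sqrt (hn x)]
  refine forall_congr' fun x => ?_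
  rw [divChi_grad hf ha x]
  have hrow : ∀ i, 0 ≤ ∑ j, pd2 f i j x ^ 2 := fun i => Finset.sum_nonneg fun j _ => sq_nonneg _
  constructor
  · intro h i j
    have hnn : 0 ≤ ∑ i, ∑ j, pd2 f i j x ^ 2 := Finset.sum_nonneg fun i _ => hrow i
    have h0 : ∑ i, ∑ j, pd2 f i j x ^ 2 = 0 := by
      have : 0 ≤ c ^ 2 * lap f x ^ 2 := by positivity
      linarith
    have hi := (Finset.sum_eq_zero_iff_of_nonneg fun i _ => hrow i).1 h0 i (Finset.mem_univ i)
    have hij := (Finset.sum_eq_zero_iff_of_nonneg fun j _ => sq_nonneg _).1 hi j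
      (Finset.mem_univ j)
    exact pow_eq_zero_iff (two_ne_zero) |>.1 hij
  · intro h
    simp [lap, h]
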